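/- Let A be a commutative Noetherian ring, let n ∈ ℕ, and let 0 → M → M_0 → M_1 → 0 be a short exact sequence of finitely generated A-modules. Assume that M_0 satisfies Serre's condition S_n, that M_1 satisfies Serre's condition S_{n−1}, and that dim (M_1)_𝔭 ≥ dim (M_0)_𝔭 − 1 for every prime ideal 𝔭 of A. Then M satisfies Serre's condition S_n. -/

import Mathlib

open RingTheory

/-- The depth of a module `N` over a (Noetherian) local ring `A`: the supremum of the
lengths of (weakly) regular sequences on `N` consisting of elements of the maximal
ideal, with the convention that the depth of the zero module is `+∞`. -/
noncomputable def moduleDepth (A : Type u) [CommRing A] [IsLocalRing A]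
    (N : Type v) [AddCommGroup N] [Module A N] : ℕ∞ :=
  open Classical in
  if Subsingleton N then ⊤
  else sSup {n : ℕ∞ | ∃ rs : List A, (rs.length : ℕ∞) = n ∧
    (∀ r ∈ rs, r ∈ IsLocalRing.maximalIdeal A) ∧ RingTheory.Sequence.IsWeaklyRegular N rs}

/-- The dimension of a module `N` over a commutative ring `A`: the Krull dimension of
its support in `Spec A` (which is `⊥` for the zero module). -/
noncomputable def moduleDim (A : Type u) [CommRing A]
    (N : Type v) [AddCommGroup N] [Module A N] : WithBot ℕ∞ :=
  Order.krullDim (Module.support A N)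

/-- The depth of the localization `N_𝔭` over `A_𝔭`. -/
noncomputable def localizedDepth (A : Type u) [CommRing A] (𝔭 : PrimeSpectrum A)
    (N : Type v) [AddCommGroup N] [Module A N] : ℕ∞ :=
  moduleDepth (Localization.AtPrime 𝔭.asIdeal) (LocalizedModule 𝔭.asIdeal.primeCompl N)

/-- The dimension of the localization `N_𝔭` over `A_𝔭`. -/
noncomputable def localizedDim (A : Type u) [CommRing A] (𝔭 : PrimeSpectrum A)
    (N : Type v) [AddCommGroup N] [Module A N] : WithBot ℕ∞ :=
  moduleDim (Localization.AtPrime 𝔭.asIdeal) (LocalizedModule 𝔭.asIdeal.primeCompl N)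

/-- Serre's condition `S_n` for a module `N` over a commutative ring `A`:
`depth_{A_𝔭} N_𝔭 ≥ min(n, dim N_𝔭)` for every prime ideal `𝔭` of `A`. -/
def SerreCondition (n : ℕ) (A : Type u) [CommRing A]
    (N : Type v) [AddCommGroup N] [Module A N] : Prop :=
  ∀ 𝔭 : PrimeSpectrum A,
    min (n : WithBot ℕ∞) (localizedDim A 𝔭 N) ≤ (localizedDepth A 𝔭 N : WithBot ℕ∞)

open CategoryTheory Abelian in
/-- For a finitely generated module over a Noetherian local ring, depth is characterised by the
vanishing of `Ext` from the residue field. -/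
lemma natCast_le_moduleDepth_iff {R : Type u} [CommRing R] [IsLocalRing R] [IsNoetherianRing R]
    [Small.{v} R] (N : Type v) [AddCommGroup N] [Module R N] [Module.Finite R N] (k : ℕ) :
    (k : ℕ∞) ≤ moduleDepth R N ↔
      ∀ i < k, Subsingleton (Ext (ModuleCat.of R (Shrink.{v} (R ⧸ IsLocalRing.maximalIdeal R)))
        (ModuleCat.of R N) i) := by
  unfold moduleDepth
  split_ifs with h
  · have h0 : 𝟙 (ModuleCat.of R N) = 0 := by
      ext x
      exact Subsingleton.elim (α := N) _ _
    simp only [le_top, true_iff]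
    refine fun i _ ↦ subsingleton_of_forall_eq 0 fun x ↦ ?_
    rw [← x.comp_mk₀_id, h0, Ext.mk₀_zero, Ext.comp_zero]
  · have : Nontrivial N := not_subsingleton_iff_nontrivial.mp h
    have smul_lt : IsLocalRing.maximalIdeal R • (⊤ : Submodule R N) < ⊤ :=
      (Submodule.top_ne_ideal_smul_of_le_jacobson_annihilator
        (IsLocalRing.maximalIdeal_le_jacobson _)).symm.lt_top
    have rees (m : ℕ) := (ModuleCat.exists_isRegular_tfae (IsLocalRing.maximalIdeal R) m
      (ModuleCat.of R N) smul_lt).out 1 3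
    constructor
    · intro hk i hi
      have hlt : (i : ℕ∞) < sSup _ := (Nat.cast_lt.mpr hi).trans_le hk
      obtain ⟨_, ⟨rs, rfl, mem, reg⟩, hlen⟩ := lt_sSup_iff.mp hlt
      exact (rees rs.length).mpr
        ⟨rs, rfl, mem, .of_isWeaklyRegular_of_mem_maximalIdeal N mem reg⟩ i (Nat.cast_lt.mp hlen)
    · intro hk
      obtain ⟨rs, hlen, mem, reg⟩ := (rees k).mp hk
      exact le_sSup ⟨rs, by rw [hlen], mem, reg.toIsWeaklyRegular⟩

open CategoryTheory Abelian in
/-- The depth lemma for the kernel of a short exact sequence. -/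
lemma le_moduleDepth_of_shortExact {R : Type u} [CommRing R] [IsLocalRing R] [IsNoetherianRing R]
    [Small.{v} R] {N N₀ N₁ : Type v} [AddCommGroup N] [AddCommGroup N₀] [AddCommGroup N₁]
    [Module R N] [Module R N₀] [Module R N₁]
    [Module.Finite R N] [Module.Finite R N₀] [Module.Finite R N₁]
    (f : N →ₗ[R] N₀) (g : N₀ →ₗ[R] N₁) (hf : Function.Injective f) (hg : Function.Surjective g)
    (hfg : Function.Exact f g) (k : ℕ) (h₀ : (k : ℕ∞) ≤ moduleDepth R N₀)
    (h₁ : ((k - 1 : ℕ) : ℕ∞) ≤ moduleDepth R N₁) :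
    (k : ℕ∞) ≤ moduleDepth R N := by
  rw [natCast_le_moduleDepth_iff] at h₀ h₁ ⊢
  have hS := ModuleCat.shortComplex_shortExact
    (ModuleCat.shortComplexOfCompEqZero f g hfg.linearMap_comp_eq_zero) hfg hf hg
  intro i hi
  have := h₀ i hi
  refine subsingleton_of_forall_eq 0 fun x ↦ ?_
  have hx : x.comp (Ext.mk₀ (ModuleCat.ofHom f)) (add_zero i) = 0 := Subsingleton.elim _ _
  cases i with
  | zero =>
    have := hS.mono_f
    obtain ⟨φ, rfl⟩ := Ext.addEquiv₀.symm.surjective x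
    have hφ : φ ≫ ModuleCat.ofHom f = 0 :=
      Subsingleton.elim (h := Ext.addEquiv₀.symm.subsingleton) _ _
    rw [Limits.zero_of_comp_mono (ModuleCat.ofHom f) hφ, map_zero]
  | succ j =>
    have := h₁ j (by omega)
    obtain ⟨y, rfl⟩ := Ext.covariant_sequence_exact₁ _ hS x hx (n₀ := j) rfl
    rw [Subsingleton.elim y 0, Ext.zero_comp]

lemma localizedDim_le_of_injective {A : Type u} [CommRing A] {M : Type v} {N : Type w}
    [AddCommGroup M] [AddCommGroup N] [Module A M] [Module A N] (f : M →ₗ[A] N)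
    (hf : Function.Injective f) (𝔭 : PrimeSpectrum A) :
    localizedDim A 𝔭 M ≤ localizedDim A 𝔭 N :=
  Module.supportDim_le_of_injective _ (LocalizedModule.map_injective 𝔭.asIdeal.primeCompl f hf)

/--
Let `A` be a commutative Noetherian ring, `n ∈ ℕ`, and
`0 → M → M₀ → M₁ → 0` a short exact sequence of finitely generated `A`-modules.
If `M₀` is `S_n`, `M₁` is `S_{n−1}`, and `dim (M₁)_𝔭 ≥ dim (M₀)_𝔭 − 1` for every prime
ideal `𝔭` of `A`, then `M` is `S_n`.
-/
theorem serre_condition_of_shortExact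
    {A : Type u} [CommRing A] [IsNoetherianRing A] (n : ℕ)
    {M M₀ M₁ : Type v} [AddCommGroup M] [AddCommGroup M₀] [AddCommGroup M₁]
    [Module A M] [Module A M₀] [Module A M₁]
    [Module.Finite A M] [Module.Finite A M₀] [Module.Finite A M₁]
    (f : M →ₗ[A] M₀) (g : M₀ →ₗ[A] M₁)
    (hf : Function.Injective f) (hg : Function.Surjective g)
    (hfg : Function.Exact f g)
    (h₀ : SerreCondition n A M₀) (h₁ : SerreCondition (n - 1) A M₁)
    (hdim : ∀ 𝔭 : PrimeSpectrum A, localizedDim A 𝔭 M₀ ≤ localizedDim A 𝔭 M₁ + 1) :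
    SerreCondition n A M := by
  intro 𝔭
  obtain hbot | ⟨k, hk⟩ : min (n : WithBot ℕ∞) (localizedDim A 𝔭 M) = ⊥ ∨
      ∃ k : ℕ, min (n : WithBot ℕ∞) (localizedDim A 𝔭 M) = k := by
    have hle := min_le_left (n : WithBot ℕ∞) (localizedDim A 𝔭 M)
    generalize min (n : WithBot ℕ∞) (localizedDim A 𝔭 M) = x at hle
    induction x with
    | bot => exact .inl rfl
    | coe x =>
      lift x to ℕ using fun h ↦ by
        subst h
        exact ENat.natCast_ne_top n (top_le_iff.mp (WithBot.coe_le_coe.mp hle))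
      exact .inr ⟨x, rfl⟩
  · simp [hbot]
  rw [hk]
  have hkn : k ≤ n := by
    have : (k : WithBot ℕ∞) ≤ n := hk ▸ min_le_left _ _
    exact_mod_cast this
  have hk₀ : (k : WithBot ℕ∞) ≤ localizedDim A 𝔭 M₀ :=
    (hk ▸ min_le_right _ _).trans (localizedDim_le_of_injective f hf 𝔭)
  have hk₁ : ((k - 1 : ℕ) : WithBot ℕ∞) ≤ localizedDim A 𝔭 M₁ := by
    have h := hk₀.trans (hdim 𝔭)
    generalize localizedDim A 𝔭 M₁ = x at h
    induction x with
    | bot => simp at h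
    | coe x =>
      have h' : (k : ℕ∞) ≤ x + 1 := WithBot.coe_le_coe.mp h
      refine WithBot.coe_le_coe.mpr ?_
      simpa using tsub_le_iff_right.mpr h'
  have hexact : Function.Exact (LocalizedModule.map 𝔭.asIdeal.primeCompl f)
      (LocalizedModule.map 𝔭.asIdeal.primeCompl g) :=
    LocalizedModule.map_exact 𝔭.asIdeal.primeCompl f g hfg
  refine WithBot.coe_le_coe.mpr (le_moduleDepth_of_shortExact _ _
    (LocalizedModule.map_injective _ f hf) (LocalizedModule.map_surjective _ g hg) hexact k
    (WithBot.coe_le_coe.mp ((le_min ?_ hk₀).trans (h₀ 𝔭)))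
    (WithBot.coe_le_coe.mp ((le_min ?_ hk₁).trans (h₁ 𝔭))))
  · exact_mod_cast hkn
  · exact_mod_cast Nat.sub_le_sub_right hkn 1
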